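/- arXiv:1705.09091 — 3 statements merged into one kernel-verified Lean document; each statement's English description precedes it below -/
import Mathlib

section
/- Let H be a complex Hilbert space and A : H → H a bounded selfadjoint operator with ⟨Au,u⟩ ≥ c‖u‖² for all u (c > 0). Let l₁,…,lₙ be positive integers, a₁,…,aₙ ≥ 0 reals, ϰ = Σₖ aₖ/lₖ ≤ 1, 0 ≤ μ ≤ 1 − ϰ, and define, for t ∈ (0,∞)ⁿ and h > 0, the operator-valued function Ψ(ξ) = (∏ₖ tₖ^{aₖ/lₖ}) (∏ₖ |ξₖ|^{aₖ}) h^{−μ} A^{1−ϰ−μ} (A + (Σₖ tₖ|ξₖ|^{lₖ} + h^{−1})·I)^{−1} on ℝⁿ. Then there exists a constant C_μ > 0, independent of t and h, such that for every index k and every ξ ∈ ℝⁿ all of whose coordinates are nonzero, Ψ is differentiable in the variable ξₖ at ξ and |ξₖ| · ‖∂_{ξₖ} Ψ(ξ)‖_{L(H)} ≤ C_μ. -/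
noncomputable section

/-- Fractional power `A^θ` of a bounded selfadjoint operator via the continuous
functional calculus applied to `s ↦ s ^ θ`. -/
def fracPow {H : Type*} [NormedAddCommGroup H] [InnerProductSpace ℂ H]
    [CompleteSpace H] (A : H →L[ℂ] H) (θ : ℝ) : H →L[ℂ] H :=
  cfc (fun s : ℝ => s ^ θ) A

/-- The operator-valued symbol
`Ψ(ξ) = (∏ k, t k ^ (a k / l k)) (∏ k, |ξ k| ^ (a k)) h^(-μ) A^(1-ϰ-μ)
    (A + (∑ k, t k |ξ k| ^ (l k) + h⁻¹) • I)⁻¹`. -/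
def Psi {H : Type*} [NormedAddCommGroup H] [InnerProductSpace ℂ H] [CompleteSpace H]
    (A : H →L[ℂ] H) (n : ℕ) (l : Fin n → ℕ) (a : Fin n → ℝ) (μ : ℝ)
    (t : Fin n → ℝ) (h : ℝ) (ξ : Fin n → ℝ) : H →L[ℂ] H :=
  (((∏ k, t k ^ (a k / (l k : ℝ))) * (∏ k, |ξ k| ^ (a k)) * h ^ (-μ) : ℝ) : ℂ) •
    (fracPow A (1 - (∑ k, a k / (l k : ℝ)) - μ) ∘L
      Ring.inverse (A + (((∑ k, t k * |ξ k| ^ (l k)) + h⁻¹ : ℝ) : ℂ) • (1 : H →L[ℂ] H)))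

/-- Weighted bound: if each `x k ≤ M`, `y ≤ M`, `z ≤ M` are nonnegative, then a product of powers
with nonnegative exponents of total weight one is at most `M`. -/
theorem prod_rpow_mul_rpow_mul_rpow_le {ι : Type*} [Fintype ι] {x w : ι → ℝ} {y z M p q : ℝ}
    (hM : 0 < M) (hx : ∀ k, 0 ≤ x k) (hxM : ∀ k, x k ≤ M) (hw : ∀ k, 0 ≤ w k)
    (hy : 0 ≤ y) (hyM : y ≤ M) (hp : 0 ≤ p) (hz : 0 ≤ z) (hzM : z ≤ M) (hq : 0 ≤ q)
    (hsum : ∑ k, w k + p + q = 1) :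
    (∏ k, x k ^ w k) * y ^ p * z ^ q ≤ M := by
  have hprod : ∏ k, x k ^ w k ≤ M ^ ∑ k, w k := by
    rw [Real.rpow_sum_of_pos hM]
    exact Finset.prod_le_prod (fun k _ => Real.rpow_nonneg (hx k) _)
      fun k _ => Real.rpow_le_rpow (hx k) (hxM k) (hw k)
  calc (∏ k, x k ^ w k) * y ^ p * z ^ q
      ≤ M ^ (∑ k, w k) * M ^ p * M ^ q := by gcongr
    _ = M := by rw [← Real.rpow_add hM, ← Real.rpow_add hM, hsum, Real.rpow_one]

theorem hasDerivAt_abs_rpow_of_ne_zero {x : ℝ} (hx : x ≠ 0) (p : ℝ) :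
    HasDerivAt (fun s : ℝ => |s| ^ p) (p * |x| ^ p / x) x := by
  have habs : |x| ≠ 0 := abs_ne_zero.mpr hx
  refine ((hasDerivAt_abs hx).rpow_const (Or.inl habs)).congr_deriv ?_
  rw [Real.rpow_sub_one habs]
  rcases lt_or_gt_of_ne hx with h | h
  · rw [abs_of_neg h, sign_neg h, SignType.coe_neg_one]
    field_simp
  · rw [abs_of_pos h, sign_pos h, SignType.coe_one]
    field_simp

theorem hasDerivAt_prod_update {ι : Type*} [Fintype ι] [DecidableEq ι] {f : ι → ℝ → ℝ}
    {ξ : ι → ℝ} {k : ι} {f' : ℝ} (hf : HasDerivAt (f k) f' (ξ k)) :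
    HasDerivAt (fun s => ∏ j, f j (Function.update ξ k s j))
      (f' * ∏ j ∈ Finset.univ.erase k, f j (ξ j)) (ξ k) := by
  refine (hf.mul_const _).congr_of_eventuallyEq (Filter.Eventually.of_forall fun s => ?_)
  simp only
  rw [← Finset.mul_prod_erase _ _ (Finset.mem_univ k), Function.update_self]
  congr 1
  exact Finset.prod_congr rfl fun j hj => by
    rw [Function.update_of_ne (Finset.ne_of_mem_erase hj)]

theorem hasDerivAt_sum_update {ι : Type*} [Fintype ι] [DecidableEq ι] {f : ι → ℝ → ℝ}
    {ξ : ι → ℝ} {k : ι} {f' : ℝ} (hf : HasDerivAt (f k) f' (ξ k)) :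
    HasDerivAt (fun s => ∑ j, f j (Function.update ξ k s j)) f' (ξ k) := by
  refine (hf.add_const (∑ j ∈ Finset.univ.erase k, f j (ξ j))).congr_of_eventuallyEq
    (Filter.Eventually.of_forall fun s => ?_)
  simp only
  rw [← Finset.add_sum_erase _ _ (Finset.mem_univ k), Function.update_self]
  congr 1
  exact Finset.sum_congr rfl fun j hj => by
    rw [Function.update_of_ne (Finset.ne_of_mem_erase hj)]

section Resolvent

variable {H : Type*} [NormedAddCommGroup H] [InnerProductSpace ℂ H] [CompleteSpace H]
  {A : H →L[ℂ] H}

theorem add_smul_one_eq_cfc (hA : IsSelfAdjoint A) (r : ℝ) :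
    A + (r : ℂ) • (1 : H →L[ℂ] H) = cfc (fun s : ℝ => s + r) A := by
  rw [cfc_add_const r (fun s : ℝ => s) A, cfc_id' ℝ A, Algebra.algebraMap_eq_smul_one,
    Complex.coe_smul]

theorem isUnit_add_smul_one (hA : 0 ≤ A) {r : ℝ} (hr : 0 < r) :
    IsUnit (A + (r : ℂ) • (1 : H →L[ℂ] H)) := by
  have hsa : IsSelfAdjoint A := .of_nonneg hA
  rw [add_smul_one_eq_cfc hsa, isUnit_cfc_iff (fun s : ℝ => s + r) A]
  intro x hx
  have := spectrum_nonneg_of_nonneg hA hx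
  positivity

theorem fracPow_mul_inverse_eq_cfc (hA : 0 ≤ A) {r θ : ℝ} (hr : 0 < r) (hθ : 0 ≤ θ) :
    fracPow A θ * Ring.inverse (A + (r : ℂ) • (1 : H →L[ℂ] H)) =
      cfc (fun s : ℝ => s ^ θ / (s + r)) A := by
  have hsa : IsSelfAdjoint A := .of_nonneg hA
  rw [add_smul_one_eq_cfc hsa, fracPow, cfc_map_div (fun s : ℝ => s ^ θ) (fun s : ℝ => s + r) A]
  · intro x hx
    have := spectrum_nonneg_of_nonneg hA hx
    positivity

theorem mul_norm_fracPow_mul_inverse_le (hA : 0 ≤ A) {r θ P : ℝ} (hr : 0 < r) (hθ : 0 ≤ θ)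
    (hP : 0 ≤ P) (hbound : ∀ s, 0 ≤ s → P * s ^ θ ≤ s + r) :
    P * ‖fracPow A θ * Ring.inverse (A + (r : ℂ) • (1 : H →L[ℂ] H))‖ ≤ 1 := by
  rcases hP.eq_or_lt with rfl | hP
  · simp
  rw [fracPow_mul_inverse_eq_cfc hA hr hθ, ← le_div_iff₀' hP]
  refine norm_cfc_le (by positivity) fun s hs => ?_
  have hs0 : 0 ≤ s := spectrum_nonneg_of_nonneg hA hs
  rw [Real.norm_of_nonneg (by positivity), div_le_div_iff₀ (by positivity) hP]
  linarith [hbound s hs0]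

theorem mul_norm_inverse_add_smul_one_le (hA : 0 ≤ A) {r : ℝ} (hr : 0 < r) :
    r * ‖Ring.inverse (A + (r : ℂ) • (1 : H →L[ℂ] H))‖ ≤ 1 := by
  have hsa : IsSelfAdjoint A := .of_nonneg hA
  have h := mul_norm_fracPow_mul_inverse_le hA hr le_rfl hr.le (θ := 0) (by simp)
  simpa [fracPow, cfc_const_one ℝ A] using h

theorem hasDerivAt_inverse_add_smul_one (hA : 0 ≤ A) {S : ℝ → ℝ} {S' x : ℝ}
    (hS : HasDerivAt S S' x) (hpos : 0 < S x) :
    HasDerivAt (fun s => Ring.inverse (A + (S s : ℂ) • (1 : H →L[ℂ] H)))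
      (-(S' : ℂ) • (Ring.inverse (A + (S x : ℂ) • (1 : H →L[ℂ] H)) *
        Ring.inverse (A + (S x : ℂ) • (1 : H →L[ℂ] H)))) x := by
  obtain ⟨u, hu⟩ := isUnit_add_smul_one hA hpos
  have hlin : HasDerivAt (fun s => A + (S s : ℂ) • (1 : H →L[ℂ] H))
      ((S' : ℂ) • (1 : H →L[ℂ] H)) x := (hS.ofReal_comp.smul_const _).const_add A
  have hinv := hasFDerivAt_ringInverse (𝕜 := ℝ) u
  rw [hu] at hinv
  refine (hinv.comp_hasDerivAt x hlin).congr_deriv ?_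
  rw [← hu, Ring.inverse_unit]
  simp

end Resolvent

/-- First-order Mikhlin-type estimate (3.8): the symbol `Ψ` is differentiable in each
variable `ξ k` at every point with nonzero coordinates, and
`|ξ k| * ‖∂_{ξ k} Ψ(ξ)‖ ≤ C_μ` uniformly in `t` and `h`. -/
theorem psi_derivative_estimate {H : Type*} [NormedAddCommGroup H] [InnerProductSpace ℂ H]
    [CompleteSpace H] (A : H →L[ℂ] H) (hA : IsSelfAdjoint A) (c : ℝ) (hc : 0 < c)
    (hcoer : ∀ u : H, c * ‖u‖ ^ 2 ≤ (inner ℂ (A u) u : ℂ).re)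
    (n : ℕ) (l : Fin n → ℕ) (hl : ∀ k, 0 < l k) (a : Fin n → ℝ) (ha : ∀ k, 0 ≤ a k)
    (μ : ℝ) (hϰ : (∑ k, a k / (l k : ℝ)) ≤ 1) (hμ0 : 0 ≤ μ)
    (hμ1 : μ ≤ 1 - ∑ k, a k / (l k : ℝ)) :
    ∃ C : ℝ, 0 < C ∧ ∀ (t : Fin n → ℝ), (∀ k, 0 < t k) → ∀ h : ℝ, 0 < h →
      ∀ k : Fin n, ∀ ξ : Fin n → ℝ, (∀ j, ξ j ≠ 0) →
      DifferentiableAt ℝ (fun s : ℝ => Psi A n l a μ t h (Function.update ξ k s)) (ξ k) ∧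
      |ξ k| * ‖deriv (fun s : ℝ => Psi A n l a μ t h (Function.update ξ k s)) (ξ k)‖ ≤ C := by
  have hpos : 0 ≤ A := by
    rw [ContinuousLinearMap.nonneg_iff_isPositive, ContinuousLinearMap.isPositive_def']
    exact ⟨hA, fun u => le_trans (by positivity) (hcoer u)⟩
  refine ⟨1 + ∑ k, (a k + l k), ?_, fun t ht h hh k ξ hξ => ?_⟩
  · have : 0 ≤ ∑ k, (a k + l k) := Finset.sum_nonneg fun k _ => add_nonneg (ha k) (by positivity)
    positivity
  set θ := 1 - (∑ k, a k / (l k : ℝ)) - μ with hθ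
  set T : ℝ := ∏ k, t k ^ (a k / (l k : ℝ)) with hT
  let S : ℝ → ℝ := fun s => (∑ j, t j * |Function.update ξ k s j| ^ (l j)) + h⁻¹
  let P : ℝ → ℝ := fun s => T * (∏ j, |Function.update ξ k s j| ^ (a j)) * h ^ (-μ)
  have hθ0 : 0 ≤ θ := by linarith
  have habs : ∀ j, 0 < |ξ j| := fun j => abs_pos.mpr (hξ j)
  have hSx : S (ξ k) = (∑ j, t j * |ξ j| ^ (l j)) + h⁻¹ := by
    simp only [S, Function.update_eq_self]
  have hPx : P (ξ k) = T * (∏ j, |ξ j| ^ (a j)) * h ^ (-μ) := by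
    simp only [P, Function.update_eq_self]
  have hterm : ∀ j, 0 ≤ t j * |ξ j| ^ (l j) := fun j => mul_nonneg (ht j).le (by positivity)
  have hterm_le : ∀ j, t j * |ξ j| ^ (l j) ≤ ∑ j, t j * |ξ j| ^ (l j) := fun j =>
    Finset.single_le_sum (f := fun j => t j * |ξ j| ^ (l j)) (fun i _ => hterm i)
      (Finset.mem_univ j)
  have hsum0 : 0 ≤ ∑ j, t j * |ξ j| ^ (l j) := Finset.sum_nonneg fun j _ => hterm j
  have hh' : 0 < h⁻¹ := inv_pos.mpr hh
  have hS0 : 0 < S (ξ k) := by rw [hSx]; positivity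
  have hT0 : 0 ≤ T := Finset.prod_nonneg fun j _ => Real.rpow_nonneg (ht j).le _
  have hP0 : 0 ≤ P (ξ k) := by
    rw [hPx]
    have : 0 ≤ ∏ j, |ξ j| ^ (a j) := Finset.prod_nonneg fun j _ => by positivity
    positivity
  have hbound : ∀ s, 0 ≤ s → P (ξ k) * s ^ θ ≤ s + S (ξ k) := by
    intro s hs
    have hle := prod_rpow_mul_rpow_mul_rpow_le (x := fun j => t j * |ξ j| ^ (l j))
      (w := fun j => a j / (l j : ℝ)) (y := h⁻¹) (z := s) (M := s + S (ξ k)) (p := μ) (q := θ)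
      (by positivity) hterm (fun j => by rw [hSx]; linarith [hterm_le j])
      (fun j => div_nonneg (ha j) (by positivity)) hh'.le (by rw [hSx]; linarith) hμ0 hs
      (by linarith) hθ0 (by rw [hθ]; ring)
    convert! hle using 2
    rw [hPx, hT, ← Finset.prod_mul_distrib, Real.inv_rpow hh.le, Real.rpow_neg hh.le]
    congr 1
    refine Finset.prod_congr rfl fun j _ => ?_
    have hlj : (l j : ℝ) ≠ 0 := by exact_mod_cast (hl j).ne'
    rw [Real.mul_rpow (ht j).le (by positivity), ← Real.rpow_natCast, ← Real.rpow_mul (abs_nonneg _),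
      mul_div_cancel₀ _ hlj]
  have hPd : HasDerivAt P (a k * P (ξ k) / ξ k) (ξ k) := by
    have hd := ((hasDerivAt_prod_update (f := fun j s => |s| ^ (a j)) (ξ := ξ)
      (hasDerivAt_abs_rpow_of_ne_zero (hξ k) (a k))).const_mul T).mul_const (h ^ (-μ))
    refine hd.congr_deriv ?_
    rw [hPx, ← Finset.mul_prod_erase _ _ (Finset.mem_univ k)]
    ring
  have hSd : HasDerivAt S (l k * (t k * |ξ k| ^ (l k)) / ξ k) (ξ k) := by
    have hpow := (hasDerivAt_abs_rpow_of_ne_zero (hξ k) (l k)).const_mul (t k)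
    simp only [Real.rpow_natCast] at hpow
    have hd := (hasDerivAt_sum_update (f := fun j s => t j * |s| ^ (l j)) hpow).add_const h⁻¹
    exact hd.congr_deriv (by ring)
  set R := Ring.inverse (A + (S (ξ k) : ℂ) • (1 : H →L[ℂ] H)) with hR
  have hΨ := hPd.ofReal_comp.smul
    ((hasDerivAt_inverse_add_smul_one hpos hSd hS0).const_mul (fracPow A θ))
  have hΨ' : HasDerivAt (fun s : ℝ => Psi A n l a μ t h (Function.update ξ k s)) _ (ξ k) := hΨ
  refine ⟨hΨ'.differentiableAt, ?_⟩
  rw [hΨ'.deriv, ← hR]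
  have hFR : P (ξ k) * ‖fracPow A θ * R‖ ≤ 1 :=
    mul_norm_fracPow_mul_inverse_le hpos hS0 hθ0 hP0 hbound
  have hSR : S (ξ k) * ‖R‖ ≤ 1 := mul_norm_inverse_add_smul_one_le hpos hS0
  have htS : t k * |ξ k| ^ (l k) ≤ S (ξ k) := by rw [hSx]; linarith [hterm_le k]
  have hfirst : |ξ k| * ‖((a k * P (ξ k) / ξ k : ℝ) : ℂ) • (fracPow A θ * R)‖ ≤ a k := by
    rw [norm_smul, Complex.norm_real, Real.norm_eq_abs, abs_div, abs_mul, abs_of_nonneg (ha k),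
      abs_of_nonneg hP0]
    calc |ξ k| * (a k * P (ξ k) / |ξ k| * ‖fracPow A θ * R‖)
        = a k * (P (ξ k) * ‖fracPow A θ * R‖) := by field_simp [(habs k).ne']
      _ ≤ a k * 1 := mul_le_mul_of_nonneg_left hFR (ha k)
      _ = a k := mul_one _
  have hsecond : |ξ k| * ‖(P (ξ k) : ℂ) • (fracPow A θ *
      (-((l k * (t k * |ξ k| ^ (l k)) / ξ k : ℝ) : ℂ) • (R * R)))‖ ≤ l k := by
    rw [mul_smul_comm, ← mul_assoc (fracPow A θ) R R, norm_smul, norm_smul, norm_neg, Complex.norm_real,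
      Complex.norm_real, Real.norm_eq_abs, Real.norm_eq_abs, abs_div, abs_of_nonneg hP0,
      abs_of_nonneg (mul_nonneg (Nat.cast_nonneg _) (hterm k))]
    calc |ξ k| * (P (ξ k) * (l k * (t k * |ξ k| ^ (l k)) / |ξ k| * ‖fracPow A θ * R * R‖))
        = l k * ((t k * |ξ k| ^ (l k)) * (P (ξ k) * ‖fracPow A θ * R * R‖)) := by
          field_simp [(habs k).ne']
      _ ≤ l k * (S (ξ k) * (P (ξ k) * (‖fracPow A θ * R‖ * ‖R‖))) := by
          gcongr
          exact norm_mul_le _ _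
      _ = l k * ((P (ξ k) * ‖fracPow A θ * R‖) * (S (ξ k) * ‖R‖)) := by ring
      _ ≤ l k * (1 * 1) := by gcongr
      _ = l k := by ring
  have hk : a k + l k ≤ ∑ j, (a j + l j) :=
    Finset.single_le_sum (f := fun j => a j + (l j : ℝ))
      (fun j _ => add_nonneg (ha j) (Nat.cast_nonneg _)) (Finset.mem_univ k)
  refine (mul_le_mul_of_nonneg_left (norm_add_le _ _) (abs_nonneg _)).trans ?_
  rw [mul_add]
  linarith
end
end

section
/- Let H be a complex Hilbert space and A : H → H a bounded selfadjoint operator with ⟨Au,u⟩ ≥ c‖u‖² for all u (c > 0). Let l₁,…,lₙ be positive integers, α = (α₁,…,αₙ) a multi-index with ϰ := Σₖ αₖ/lₖ ≤ 1, and 0 ≤ μ ≤ 1 − ϰ. Then there exists C_μ > 0 such that for every u ∈ S(ℝⁿ; H), every h > 0 and every t ∈ (0,∞)ⁿ: (∏ₖ tₖ^{αₖ/lₖ}) ‖x ↦ A^{1−ϰ−μ}(D^α u(x))‖_{L²(ℝⁿ;H)} ≤ C_μ [ h^μ ( ‖x ↦ A(u(x))‖_{L²(ℝⁿ;H)} +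 Σₖ tₖ ‖∂ₖ^{lₖ} u‖_{L²(ℝⁿ;H)} + ‖u‖_{L²(ℝⁿ;H)} ) + h^{−(1−μ)} ‖u‖_{L²(ℝⁿ;H)} ]. -/
open MeasureTheory

noncomputable section

/-- `i`-th classical partial derivative in the `k`-th coordinate of a Schwartz function. -/
def pdIter (n : ℕ) {H : Type*} [NormedAddCommGroup H] [NormedSpace ℝ H] (k : Fin n)
    (i : ℕ) (u : SchwartzMap (Fin n → ℝ) H) : SchwartzMap (Fin n → ℝ) H :=
  (fun v => LineDeriv.lineDerivOpCLM ℝ (SchwartzMap (Fin n → ℝ) H) (Pi.single k 1 : Fin n → ℝ) v)^[i] u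

/-- The mixed partial derivative `D^α u = ∂₁^{α₁} ⋯ ∂ₙ^{αₙ} u` of a Schwartz function. -/
def Dmix (n : ℕ) {H : Type*} [NormedAddCommGroup H] [NormedSpace ℝ H] (α : Fin n → ℕ)
    (u : SchwartzMap (Fin n → ℝ) H) : SchwartzMap (Fin n → ℝ) H :=
  (List.finRange n).foldl (fun v k => pdIter n k (α k) v) u

/-- The Bochner `L²(ℝⁿ; H)` norm of a function. -/
def L2N (n : ℕ) {H : Type*} [NormedAddCommGroup H] (f : (Fin n → ℝ) → H) : ℝ :=
  (∫ x, ‖f x‖ ^ 2) ^ ((1 : ℝ) / 2)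

open scoped FourierTransform
open SchwartzMap

theorem rpow_mul_self_le_of_nonneg {s p θ : ℝ} (hs : 0 ≤ s) (hp : 0 < p) (hθ0 : 0 ≤ θ)
    (hθ1 : θ ≤ 1) :
    s ^ θ * s ^ θ ≤ θ * p ^ (θ - 1) * (s * s) + (1 - θ) * p ^ θ := by
  have key := Real.geom_mean_le_arith_mean2_weighted hθ0 (sub_nonneg.2 hθ1)
    (by positivity : 0 ≤ s * s / p) zero_le_one (by ring)
  rw [Real.one_rpow, mul_one, mul_one, Real.div_rpow (by positivity) hp.le,
    Real.mul_rpow hs hs, div_le_iff₀ (by positivity)] at key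
  refine key.trans_eq ?_
  rw [Real.rpow_sub_one hp.ne']
  ring

/-- The moment inequality for fractional powers of a strictly positive operator. -/
theorem norm_fracPow_apply_le {H : Type*} [NormedAddCommGroup H] [InnerProductSpace ℂ H]
    [CompleteSpace H] {A : H →L[ℂ] H} (hA : IsSelfAdjoint A) {c : ℝ} (hc : 0 < c)
    (hcoer : ∀ u : H, c * ‖u‖ ^ 2 ≤ (inner ℂ (A u) u : ℂ).re) {θ : ℝ} (hθ0 : 0 ≤ θ)
    (hθ1 : θ ≤ 1) (v : H) :
    ‖fracPow A θ v‖ ≤ ‖A v‖ ^ θ * ‖v‖ ^ (1 - θ) := by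
  rcases eq_or_ne v 0 with rfl | hv
  · rw [map_zero, norm_zero]; positivity
  have hv0 : 0 < ‖v‖ := norm_pos_iff.2 hv
  have hAv : 0 < ‖A v‖ := by
    refine norm_pos_iff.2 fun h0 => ?_
    have := hcoer v
    rw [h0, inner_zero_left, Complex.zero_re] at this
    nlinarith [mul_pos hc (pow_pos hv0 2)]
  have hApos : 0 ≤ A := by
    rw [ContinuousLinearMap.nonneg_iff_isPositive, ContinuousLinearMap.isPositive_def']
    refine ⟨hA, fun x => ?_⟩
    rw [ContinuousLinearMap.reApplyInnerSelf_apply]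
    exact le_trans (by positivity) (hcoer x)
  set p : ℝ := (‖A v‖ / ‖v‖) ^ 2 with hp
  have hp0 : 0 < p := by positivity
  have hcont : Continuous fun s : ℝ => s ^ θ := Real.continuous_rpow_const hθ0
  have hle : fracPow A θ * fracPow A θ ≤
      (θ * p ^ (θ - 1)) • (A * A) + ((1 - θ) * p ^ θ) • (1 : H →L[ℂ] H) := by
    have h1 : fracPow A θ * fracPow A θ = cfc (fun s : ℝ => s ^ θ * s ^ θ) A :=
      (cfc_mul _ _ A hcont.continuousOn hcont.continuousOn).symm
    have h2 : (θ * p ^ (θ - 1)) • (A * A) + ((1 - θ) * p ^ θ) • (1 : H →L[ℂ] H) =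
        cfc (fun s : ℝ => θ * p ^ (θ - 1) * (s * s) + (1 - θ) * p ^ θ) A := by
      rw [cfc_add_const _ _ A (by fun_prop), cfc_const_mul _ _ A (by fun_prop),
        cfc_mul (fun s : ℝ => s) (fun s : ℝ => s) A (by fun_prop) (by fun_prop), cfc_id' ℝ A,
        Algebra.algebraMap_eq_smul_one]
    rw [h1, h2]
    refine cfc_mono (fun s hs => ?_) (hcont.mul hcont).continuousOn (by fun_prop)
    exact rpow_mul_self_le_of_nonneg (spectrum_nonneg_of_nonneg hApos hs) hp0 hθ0 hθ1
  have hsa : IsSelfAdjoint (fracPow A θ) := cfc_predicate _ A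
  have hsq (B : H →L[ℂ] H) (hB : IsSelfAdjoint B) : (inner ℂ ((B * B) v) v).re = ‖B v‖ ^ 2 := by
    rw [mul_apply_eq_comp, ← ContinuousLinearMap.adjoint_inner_right,
      hB.adjoint_eq]
    exact inner_self_eq_norm_sq (𝕜 := ℂ) _
  have hin := (ContinuousLinearMap.le_def _ _).1 hle |>.re_inner_nonneg_left v
  have hmain : ‖fracPow A θ v‖ ^ 2 ≤
      θ * p ^ (θ - 1) * ‖A v‖ ^ 2 + (1 - θ) * p ^ θ * ‖v‖ ^ 2 := by
    have hvv : (inner ℂ v v : ℂ).re = ‖v‖ ^ 2 := inner_self_eq_norm_sq (𝕜 := ℂ) v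
    simp only [sub_apply, add_apply, inner_sub_left,
      inner_add_left, smul_apply, inner_smul_left_eq_smul,
      one_apply_eq_self, RCLike.re_to_complex, Complex.sub_re, Complex.add_re,
      Complex.real_smul, Complex.re_ofReal_mul, hsq _ hsa, hsq _ hA, hvv] at hin
    linarith
  have hpv : ‖A v‖ ^ 2 = p * ‖v‖ ^ 2 := by rw [hp]; field_simp
  have hfin : ‖fracPow A θ v‖ ^ 2 ≤ (‖A v‖ ^ θ * ‖v‖ ^ (1 - θ)) ^ 2 := by
    refine hmain.trans_eq ?_
    have : ‖A v‖ ^ θ * ‖v‖ ^ (1 - θ) = (‖A v‖ / ‖v‖) ^ θ * ‖v‖ := by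
      rw [Real.rpow_sub hv0, Real.div_rpow hAv.le hv0.le, Real.rpow_one]
      ring
    rw [this, mul_pow, ← Real.rpow_mul_natCast (by positivity), mul_comm θ (2 : ℕ),
      Real.rpow_natCast_mul (by positivity), ← hp, hpv, Real.rpow_sub_one hp0.ne']
    field_simp
    ring
  exact le_of_sq_le_sq hfin (by positivity)

/-- Weighted arithmetic-geometric mean inequality for the anisotropic Fourier symbol. -/
theorem anisotropic_symbol_le {n : ℕ} {l : Fin n → ℕ} (hl : ∀ k, 0 < l k) (α : Fin n → ℕ)
    {μ : ℝ} (hμ0 : 0 ≤ μ) (hμ1 : μ ≤ 1 - ∑ k, (α k : ℝ) / (l k : ℝ)) {h : ℝ} (hh : 0 < h)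
    {t : Fin n → ℝ} (ht : ∀ k, 0 < t k) {y : Fin n → ℝ} (hy : ∀ k, 0 ≤ y k) {a b : ℝ}
    (ha : 0 ≤ a) (hb : 0 ≤ b) :
    (∏ k, t k ^ ((α k : ℝ) / (l k : ℝ))) * ((∏ k, y k ^ α k) *
      (a ^ (1 - (∑ k, (α k : ℝ) / (l k : ℝ)) - μ) *
        b ^ (1 - (1 - (∑ k, (α k : ℝ) / (l k : ℝ)) - μ)))) ≤
      h ^ μ * (a + (∑ k, t k * (y k ^ l k * b)) + b) + h ^ (-(1 - μ)) * b := by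
  set w : Fin n → ℝ := fun k => (α k : ℝ) / (l k : ℝ) with hw
  have hw0 (k) : 0 ≤ w k := by simp only [hw]; positivity
  have hs0 : 0 ≤ ∑ k, w k := Finset.sum_nonneg fun k _ => hw0 k
  have hw1 (k) : w k ≤ 1 := by
    have := Finset.single_le_sum (fun k _ => hw0 k) (Finset.mem_univ k)
    simp only [hw] at *
    linarith
  change (∏ k, t k ^ w k) * ((∏ k, y k ^ α k) *
    (a ^ (1 - (∑ k, w k) - μ) * b ^ (1 - (1 - (∑ k, w k) - μ)))) ≤ _
  change μ ≤ 1 - ∑ k, w k at hμ1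
  set θ : ℝ := 1 - (∑ k, w k) - μ with hθ
  have hz0 (k) : 0 ≤ h ^ μ * (t k * (y k ^ l k * b)) := by
    have := (ht k).le
    have := hy k
    positivity
  have key := Real.geom_mean_le_arith_mean_weighted (Finset.univ : Finset (Option (Option (Fin n))))
    (fun i => i.elim μ (fun j => j.elim θ w))
    (fun i => i.elim (h ^ (-(1 - μ)) * b)
      (fun j => j.elim (h ^ μ * a) (fun k => h ^ μ * (t k * (y k ^ l k * b)))))
    (by
      rintro (_ | _ | k) -
      exacts [hμ0, by simp only [Option.elim]; linarith, hw0 k])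
    (by simp [Fintype.sum_option, hθ]; ring)
    (by
      rintro (_ | _ | k) -
      exacts [by simp only [Option.elim]; positivity, by simp only [Option.elim]; positivity,
        hz0 k])
  simp only [Fintype.sum_option, Fintype.prod_option, Option.elim] at key
  have hprod : ∏ k, (h ^ μ * (t k * (y k ^ l k * b))) ^ w k =
      h ^ (μ * ∑ k, w k) * ((∏ k, t k ^ w k) * ((∏ k, y k ^ α k) * b ^ ∑ k, w k)) := by
    rw [Real.rpow_mul hh.le, Real.rpow_sum_of_nonneg (by positivity) fun k _ => hw0 k,
      Real.rpow_sum_of_nonneg hb fun k _ => hw0 k, ← Finset.prod_mul_distrib,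
      ← Finset.prod_mul_distrib, ← Finset.prod_mul_distrib]
    refine Finset.prod_congr rfl fun k _ => ?_
    have h1 := (ht k).le
    have h2 := hy k
    rw [Real.mul_rpow (by positivity) (by positivity), Real.mul_rpow h1 (by positivity),
      Real.mul_rpow (by positivity) hb, ← Real.rpow_natCast_mul h2]
    have hlk : (l k : ℝ) ≠ 0 := by exact_mod_cast (hl k).ne'
    rw [show (l k : ℝ) * w k = (α k : ℝ) by simp only [hw]; field_simp, Real.rpow_natCast]
  have hlhs : (∏ k, t k ^ w k) * ((∏ k, y k ^ α k) * (a ^ θ * b ^ (1 - θ))) =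
      (h ^ (-(1 - μ)) * b) ^ μ * ((h ^ μ * a) ^ θ *
        ∏ k, (h ^ μ * (t k * (y k ^ l k * b))) ^ w k) := by
    rw [hprod, Real.mul_rpow (by positivity) hb, Real.mul_rpow (by positivity) ha,
      ← Real.rpow_mul hh.le, ← Real.rpow_mul hh.le,
      show (1 - θ) = (∑ k, w k) + μ by rw [hθ]; ring, Real.rpow_add_of_nonneg hb hs0 hμ0]
    have hone : h ^ (-(1 - μ) * μ) * (h ^ (μ * θ) * h ^ (μ * ∑ k, w k)) = 1 := by
      rw [← Real.rpow_add hh, ← Real.rpow_add hh, hθ, ← Real.rpow_zero h]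
      congr 1
      ring
    linear_combination
      -((∏ k, t k ^ w k) * ((∏ k, y k ^ α k) * (a ^ θ * (b ^ (∑ k, w k) * b ^ μ)))) * hone
  rw [hlhs]
  refine key.trans ?_
  have e1 : μ * (h ^ (-(1 - μ)) * b) ≤ h ^ (-(1 - μ)) * b :=
    mul_le_of_le_one_left (by positivity) (by linarith)
  have e2 : θ * (h ^ μ * a) ≤ h ^ μ * a :=
    mul_le_of_le_one_left (by positivity) (by linarith)
  have e3 : ∑ k, w k * (h ^ μ * (t k * (y k ^ l k * b))) ≤
      h ^ μ * ∑ k, t k * (y k ^ l k * b) := by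
    rw [Finset.mul_sum]
    exact Finset.sum_le_sum fun k _ => mul_le_of_le_one_left (hz0 k) (hw1 k)
  have e4 : 0 ≤ h ^ μ * b := by positivity
  linarith

/-- Fourier transform of a Schwartz function on `Fin n → ℝ`, taken on Euclidean space. -/
def piFourier {n : ℕ} {H : Type*} [NormedAddCommGroup H] [NormedSpace ℂ H]
    (u : SchwartzMap (Fin n → ℝ) H) : SchwartzMap (EuclideanSpace ℝ (Fin n)) H :=
  𝓕 (compCLMOfContinuousLinearEquiv ℝ (EuclideanSpace.equiv (Fin n) ℝ) u)

theorem piFourier_postcompCLM {n : ℕ} {H : Type*} [NormedAddCommGroup H] [NormedSpace ℂ H]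
    [CompleteSpace H] (B : H →L[ℂ] H) (u : SchwartzMap (Fin n → ℝ) H)
    (ξ : EuclideanSpace ℝ (Fin n)) :
    piFourier (u.postcompCLM B) ξ = B (piFourier u ξ) := by
  simp only [piFourier, fourier_coe, Real.fourier_eq]
  rw [← B.integral_comp_comm]
  · refine integral_congr_ae (.of_forall fun x => ?_)
    simp [Circle.smul_def]
  · simpa using (Real.fourierIntegral_convergent_iff ξ).2
      (compCLMOfContinuousLinearEquiv ℝ (EuclideanSpace.equiv (Fin n) ℝ) u).integrable

theorem piFourier_pdIter {n : ℕ} {H : Type*} [NormedAddCommGroup H] [NormedSpace ℂ H]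
    [CompleteSpace H] (k : Fin n) (i : ℕ) (u : SchwartzMap (Fin n → ℝ) H)
    (ξ : EuclideanSpace ℝ (Fin n)) :
    piFourier (pdIter n k i u) ξ =
      (2 * (Real.pi : ℂ) * Complex.I * (ξ k : ℂ)) ^ i • piFourier u ξ := by
  induction i with
  | zero => simp [pdIter]
  | succ i ih =>
    have hcomp : piFourier (pdIter n k (i + 1) u) =
        𝓕 (LineDeriv.lineDerivOp (EuclideanSpace.single k (1 : ℝ))
          (compCLMOfContinuousLinearEquiv ℝ (EuclideanSpace.equiv (Fin n) ℝ)
            (pdIter n k i u))) := by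
      rw [lineDerivOp_compCLMOfContinuousLinearEquiv]
      simp only [piFourier, pdIter, Function.iterate_succ_apply']
      rfl
    have hg : (fun x : EuclideanSpace ℝ (Fin n) =>
        inner ℝ x (EuclideanSpace.single k (1 : ℝ))).HasTemperateGrowth := by fun_prop
    rw [hcomp, fourier_lineDerivOp_eq, smul_apply, smulLeftCLM_apply_apply hg, pow_succ',
      mul_smul _ (_ ^ i), ← ih, piFourier]
    simp [mul_smul, EuclideanSpace.inner_single_right]

theorem piFourier_Dmix {n : ℕ} {H : Type*} [NormedAddCommGroup H] [NormedSpace ℂ H]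
    [CompleteSpace H] (α : Fin n → ℕ) (u : SchwartzMap (Fin n → ℝ) H)
    (ξ : EuclideanSpace ℝ (Fin n)) :
    piFourier (Dmix n α u) ξ =
      (∏ k, (2 * (Real.pi : ℂ) * Complex.I * (ξ k : ℂ)) ^ α k) • piFourier u ξ := by
  have hfold (L : List (Fin n)) (v : SchwartzMap (Fin n → ℝ) H) :
      piFourier (L.foldl (fun v k => pdIter n k (α k) v) v) ξ =
        (L.map fun k => (2 * (Real.pi : ℂ) * Complex.I * (ξ k : ℂ)) ^ α k).prod •
          piFourier v ξ := by
    induction L generalizing v with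
    | nil => simp
    | cons k L ih =>
      rw [List.foldl_cons, ih, piFourier_pdIter, List.map_cons, List.prod_cons, smul_smul,
        mul_comm]
  rw [Dmix, hfold, ← List.ofFn_eq_map, List.prod_ofFn]

/-- Plancherel's theorem for `piFourier`. -/
theorem L2N_eq_lpNorm_piFourier {n : ℕ} {H : Type*} [NormedAddCommGroup H]
    [InnerProductSpace ℂ H] [CompleteSpace H] (u : SchwartzMap (Fin n → ℝ) H) :
    L2N n u = lpNorm (piFourier u) 2 volume := by
  rw [lpNorm_eq_integral_norm_rpow_toReal two_ne_zero ENNReal.ofNat_ne_top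
    (piFourier u).continuous.aestronglyMeasurable, L2N]
  simp only [ENNReal.toReal_ofNat, Real.rpow_ofNat, one_div]
  rw [piFourier, integral_norm_sq_fourier]
  congr 1
  exact ((PiLp.volume_preserving_ofLp (Fin n)).integral_comp
    (MeasurableEquiv.toLp 2 (Fin n → ℝ)).symm.measurableEmbedding fun x => ‖u x‖ ^ 2).symm

theorem mul_lpNorm_le_sum {E ι G : Type*} [MeasurableSpace E] {ν : Measure E}
    [NormedAddCommGroup G] {s : Finset ι} {T : ℝ} (hT : 0 ≤ T) {a : ι → ℝ} (ha : ∀ i ∈ s, 0 ≤ a i)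
    {p : ENNReal} (hp : 1 ≤ p) {f : E → G} {g : ι → E → G} (hf : AEStronglyMeasurable f ν)
    (hg : ∀ i ∈ s, MemLp (g i) p ν) (hle : ∀ x, T * ‖f x‖ ≤ ∑ i ∈ s, a i * ‖g i x‖) :
    T * lpNorm f p ν ≤ ∑ i ∈ s, a i * lpNorm (g i) p ν := by
  have hm (i) (hi : i ∈ s) : MemLp (a i • fun x => ‖g i x‖) p ν := (hg i hi).norm.const_smul _
  calc T * lpNorm f p ν = lpNorm (T • fun x => ‖f x‖) p ν := by
        rw [lpNorm_const_smul, lpNorm_norm hf]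
        simp [abs_of_nonneg hT]
    _ ≤ lpNorm (∑ i ∈ s, a i • fun x => ‖g i x‖) p ν := by
        refine lpNorm_mono_real (memLp_finsetSum' s hm) fun x => ?_
        simpa [abs_of_nonneg hT] using hle x
    _ ≤ ∑ i ∈ s, lpNorm (a i • fun x => ‖g i x‖) p ν := lpNorm_sum_le hm hp
    _ = ∑ i ∈ s, a i * lpNorm (g i) p ν := by
        refine Finset.sum_congr rfl fun i hi => ?_
        rw [lpNorm_const_smul, lpNorm_norm (hg i hi).aestronglyMeasurable]
        simp [abs_of_nonneg (ha i hi)]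

/-- Theorem 3.1 (estimate (3.2)) in the Hilbert-space case with `p = q = 2` and weight
`γ ≡ 1`: `(∏ k, t k ^ (α k / l k)) ‖A^(1-ϰ-μ) D^α u‖_{L²} ≤ C_μ [h^μ (‖A u‖_{L²}
+ ∑ k, t k ‖∂ₖ^{l k} u‖_{L²} + ‖u‖_{L²}) + h^(-(1-μ)) ‖u‖_{L²}]`. -/
theorem embedding_estimate_hilbert {H : Type*} [NormedAddCommGroup H] [InnerProductSpace ℂ H]
    [CompleteSpace H] (A : H →L[ℂ] H) (hA : IsSelfAdjoint A) (c : ℝ) (hc : 0 < c)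
    (hcoer : ∀ u : H, c * ‖u‖ ^ 2 ≤ (inner ℂ (A u) u : ℂ).re)
    (n : ℕ) (l : Fin n → ℕ) (hl : ∀ k, 0 < l k) (α : Fin n → ℕ)
    (hϰ : (∑ k, (α k : ℝ) / (l k : ℝ)) ≤ 1) (μ : ℝ) (hμ0 : 0 ≤ μ)
    (hμ1 : μ ≤ 1 - ∑ k, (α k : ℝ) / (l k : ℝ)) :
    ∃ C : ℝ, 0 < C ∧ ∀ u : SchwartzMap (Fin n → ℝ) H, ∀ h : ℝ, 0 < h →
      ∀ t : Fin n → ℝ, (∀ k, 0 < t k) →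
      (∏ k, t k ^ ((α k : ℝ) / (l k : ℝ))) *
        L2N n (fun x => fracPow A (1 - (∑ k, (α k : ℝ) / (l k : ℝ)) - μ) (Dmix n α u x))
      ≤ C * (h ^ μ * (L2N n (fun x => A (u x)) +
              (∑ k, t k * L2N n (fun x => pdIter n k (l k) u x)) +
              L2N n (fun x => u x)) +
             h ^ (-(1 - μ)) * L2N n (fun x => u x)) := by
  refine ⟨1, one_pos, fun u h hh t ht => ?_⟩
  set θ : ℝ := 1 - (∑ k, (α k : ℝ) / (l k : ℝ)) - μ with hθ
  have hs0 : 0 ≤ ∑ k, (α k : ℝ) / (l k : ℝ) := Finset.sum_nonneg fun k _ => by positivity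
  have hθ0 : 0 ≤ θ := by linarith
  have hθ1 : θ ≤ 1 := by linarith
  have hT : 0 ≤ ∏ k, t k ^ ((α k : ℝ) / (l k : ℝ)) :=
    Finset.prod_nonneg fun k _ => Real.rpow_nonneg (ht k).le _
  rw [show L2N n (fun x => fracPow A θ (Dmix n α u x)) = _ from
      L2N_eq_lpNorm_piFourier ((Dmix n α u).postcompCLM (fracPow A θ)),
    show L2N n (fun x => A (u x)) = _ from L2N_eq_lpNorm_piFourier (u.postcompCLM A),
    show L2N n (fun x => u x) = _ from L2N_eq_lpNorm_piFourier u,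
    Finset.sum_congr rfl fun k _ => congrArg (t k * ·)
      (L2N_eq_lpNorm_piFourier (pdIter n k (l k) u))]
  have key := mul_lpNorm_le_sum (ν := volume) (p := 2) (s := Finset.univ) hT
    (a := fun i : Option (Option (Fin n)) =>
      i.elim (h ^ μ + h ^ (-(1 - μ))) fun j => j.elim (h ^ μ) fun k => h ^ μ * t k)
    (g := fun i => i.elim ⇑(piFourier u) fun j => j.elim ⇑(piFourier (u.postcompCLM A))
      fun k => ⇑(piFourier (pdIter n k (l k) u)))
    (f := piFourier ((Dmix n α u).postcompCLM (fracPow A θ)))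
    (by
      rintro (_ | _ | k) - <;> simp only [Option.elim]
      exacts [by positivity, by positivity, mul_nonneg (by positivity) (ht k).le])
    one_le_two (SchwartzMap.continuous _).aestronglyMeasurable
    (by rintro (_ | _ | k) - <;> exact SchwartzMap.memLp _ _ _)
    (fun ξ => by
      have hsym := anisotropic_symbol_le hl α hμ0 hμ1 hh ht
        (y := fun k => ‖2 * (Real.pi : ℂ) * Complex.I * (ξ k : ℂ)‖) (fun k => norm_nonneg _)
        (norm_nonneg (A (piFourier u ξ))) (norm_nonneg (piFourier u ξ))
      rw [piFourier_postcompCLM, piFourier_Dmix, map_smul, norm_smul, norm_prod]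
      simp only [norm_pow, Fintype.sum_option, Option.elim, piFourier_postcompCLM,
        piFourier_pdIter, norm_smul, mul_assoc (h ^ μ) (t _), ← Finset.mul_sum]
      grw [norm_fracPow_apply_le hA hc hcoer hθ0 hθ1]
      linarith)
  simp only [Fintype.sum_option, Option.elim, mul_assoc (h ^ μ) (t _), ← Finset.mul_sum] at key
  linarith
end
end

section
/- Let H be a complex Hilbert space and A : H → H a bounded selfadjoint operator with ⟨Au,u⟩ ≥ c‖u‖² for all u (c > 0). Let l₁,…,lₙ be positive integers, α a multi-index with ϰ := Σₖ αₖ/lₖ ≤ 1, and 0 < μ ≤ 1 − ϰ. Then there exists C_μ > 0 such that for every u ∈ S(ℝⁿ; H): ‖x ↦ A^{1−ϰ−μ}(D^α u(x))‖_{L²(ℝⁿ;H)} ≤ C_μ ( ‖x ↦ A(u(x))‖_{L²(ℝⁿ;H)} + Σₖ ‖∂ₖ^{lₖ} u‖_{L²(ℝⁿ;H)} + ‖u‖_{L²(ℝⁿ;H)} )^{1−μ} · ‖u‖_{L²(ℝⁿ;H)}^{μ}. -/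
open MeasureTheory

noncomputable section

open FourierTransform LineDeriv

section Fourier

variable {n : ℕ} {H : Type*} [NormedAddCommGroup H] [InnerProductSpace ℂ H]

/-- The Fourier transform of a Schwartz function on `Fin n → ℝ`, computed on `EuclideanSpace`. -/
def euclFourier (u : SchwartzMap (Fin n → ℝ) H) : SchwartzMap (EuclideanSpace ℝ (Fin n)) H :=
  𝓕 (SchwartzMap.compCLMOfContinuousLinearEquiv ℂ (EuclideanSpace.equiv (Fin n) ℝ) u)

theorem norm_euclFourier_lineDeriv (k : Fin n) (u : SchwartzMap (Fin n → ℝ) H)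
    (ξ : EuclideanSpace ℝ (Fin n)) :
    ‖euclFourier (∂_{(Pi.single k 1 : Fin n → ℝ)} u) ξ‖ =
      (2 * Real.pi * |ξ k|) * ‖euclFourier u ξ‖ := by
  have hg : (fun x : EuclideanSpace ℝ (Fin n) =>
      inner ℝ x (EuclideanSpace.single k (1 : ℝ))).HasTemperateGrowth := by fun_prop
  have he : (EuclideanSpace.equiv (Fin n) ℝ) (EuclideanSpace.single k 1) = Pi.single k 1 := by
    ext; simp [Pi.single_apply]
  rw [euclFourier, ← he, ← SchwartzMap.lineDerivOp_compCLMOfContinuousLinearEquiv,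
    SchwartzMap.fourier_lineDerivOp_eq, ← euclFourier, smul_apply,
    SchwartzMap.smulLeftCLM_apply_apply hg]
  simp [EuclideanSpace.inner_single_right, norm_smul, abs_of_pos Real.pi_pos, mul_assoc]

theorem norm_euclFourier_pdIter (k : Fin n) (i : ℕ) (u : SchwartzMap (Fin n → ℝ) H)
    (ξ : EuclideanSpace ℝ (Fin n)) :
    ‖euclFourier (pdIter n k i u) ξ‖ = (2 * Real.pi * |ξ k|) ^ i * ‖euclFourier u ξ‖ := by
  induction i with
  | zero => simp [pdIter]
  | succ i ih =>
    have h : pdIter n k (i + 1) u = ∂_{(Pi.single k 1 : Fin n → ℝ)} (pdIter n k i u) := by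
      simp only [pdIter, Function.iterate_succ_apply', lineDerivOpCLM_apply]
    rw [h, norm_euclFourier_lineDeriv, ih, pow_succ']
    ring

theorem norm_euclFourier_Dmix (α : Fin n → ℕ) (u : SchwartzMap (Fin n → ℝ) H)
    (ξ : EuclideanSpace ℝ (Fin n)) :
    ‖euclFourier (Dmix n α u) ξ‖ = (∏ k, (2 * Real.pi * |ξ k|) ^ α k) * ‖euclFourier u ξ‖ := by
  have h : ∀ (L : List (Fin n)) (v : SchwartzMap (Fin n → ℝ) H),
      ‖euclFourier (L.foldl (fun v k => pdIter n k (α k) v) v) ξ‖ =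
        (L.map fun k => (2 * Real.pi * |ξ k|) ^ α k).prod * ‖euclFourier v ξ‖ := by
    intro L
    induction L with
    | nil => simp
    | cons k L ih =>
      intro v
      rw [List.foldl_cons, ih, norm_euclFourier_pdIter, List.map_cons, List.prod_cons]
      ring
  rw [Dmix, h, ← List.ofFn_eq_map, List.prod_ofFn]

theorem L2N_nonneg {E : Type*} [NormedAddCommGroup E] (f : (Fin n → ℝ) → E) : 0 ≤ L2N n f :=
  Real.rpow_nonneg (integral_nonneg fun _ => by positivity) _

theorem L2N_clm_comp_le (B : H →L[ℂ] H) (u : SchwartzMap (Fin n → ℝ) H) :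
    L2N n (fun x => B (u x)) ≤ ‖B‖ * L2N n (fun x => u x) := by
  have hint : Integrable (fun x => ‖B‖ ^ 2 * ‖u x‖ ^ 2) :=
    ((u.memLp 2).integrable_norm_pow two_ne_zero).const_mul _
  have h : ∫ x, ‖B (u x)‖ ^ 2 ≤ ‖B‖ ^ 2 * ∫ x, ‖u x‖ ^ 2 := by
    rw [← integral_const_mul]
    refine integral_mono_of_nonneg (.of_forall fun _ => by positivity) hint
      (.of_forall fun x => ?_)
    simpa [mul_pow] using pow_le_pow_left₀ (norm_nonneg _) (B.le_opNorm (u x)) 2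
  simp only [L2N, ← Real.sqrt_eq_rpow]
  calc _ ≤ √(‖B‖ ^ 2 * ∫ x, ‖u x‖ ^ 2) := Real.sqrt_le_sqrt h
    _ = _ := by rw [Real.sqrt_mul (by positivity), Real.sqrt_sq (norm_nonneg _)]

variable [CompleteSpace H]

theorem ofReal_L2N (u : SchwartzMap (Fin n → ℝ) H) :
    ENNReal.ofReal (L2N n fun x => u x) =
      (∫⁻ ξ, ‖euclFourier u ξ‖ₑ ^ 2) ^ ((1 : ℝ) / 2) := by
  have hI : ∫ x, ‖u x‖ ^ 2 = ∫ ξ, ‖euclFourier u ξ‖ ^ 2 := by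
    rw [euclFourier, SchwartzMap.integral_norm_sq_fourier]
    exact ((PiLp.volume_preserving_ofLp (Fin n)).integral_comp
      (MeasurableEquiv.toLp 2 (Fin n → ℝ)).symm.measurableEmbedding
      (fun x => ‖u x‖ ^ 2)).symm
  have hint : Integrable (fun ξ => ‖euclFourier u ξ‖ ^ 2) :=
    ((euclFourier u).memLp 2).integrable_norm_pow two_ne_zero
  rw [L2N, hI, ← ENNReal.ofReal_rpow_of_nonneg (integral_nonneg fun _ => by positivity)
    (by norm_num), ofReal_integral_eq_lintegral_ofReal hint (.of_forall fun _ => by positivity)]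
  congr 2 with ξ
  rw [ENNReal.ofReal_pow (norm_nonneg _), ofReal_norm]

/-- Anisotropic Gagliardo–Nirenberg inequality in `L²`. -/
theorem L2N_Dmix_le (l : Fin n → ℕ) (hl : ∀ k, 0 < l k) (α : Fin n → ℕ)
    (hα : (∑ k, (α k : ℝ) / (l k : ℝ)) ≤ 1) (u : SchwartzMap (Fin n → ℝ) H) :
    L2N n (fun x => Dmix n α u x) ≤
      L2N n (fun x => u x) ^ (1 - ∑ k, (α k : ℝ) / (l k : ℝ)) *
        ∏ k, L2N n (fun x => pdIter n k (l k) u x) ^ ((α k : ℝ) / (l k : ℝ)) := by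
  have hq : 0 ≤ 1 - ∑ k, (α k : ℝ) / (l k : ℝ) := by linarith
  have hp : ∀ k, 0 ≤ (α k : ℝ) / (l k : ℝ) := fun k => by positivity
  have hmeas : ∀ v : SchwartzMap (Fin n → ℝ) H,
      AEMeasurable (fun ξ => ‖euclFourier v ξ‖ₑ ^ 2) :=
    fun v => ((euclFourier v).continuous.enorm.measurable.pow_const 2).aemeasurable
  have key := ENNReal.lintegral_mul_prod_norm_pow_le (μ := volume) Finset.univ (hmeas u)
    (fun k _ => hmeas (pdIter n k (l k) u)) (q := 1 - ∑ k, (α k : ℝ) / (l k : ℝ))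
    (p := fun k => (α k : ℝ) / (l k : ℝ)) (by ring) hq (fun k _ => hp k)
  have hpt : ∀ ξ, ‖euclFourier (Dmix n α u) ξ‖ₑ ^ 2 =
      (‖euclFourier u ξ‖ₑ ^ 2) ^ (1 - ∑ k, (α k : ℝ) / (l k : ℝ)) *
        ∏ k, (‖euclFourier (pdIter n k (l k) u) ξ‖ₑ ^ 2) ^ ((α k : ℝ) / (l k : ℝ)) := by
    intro ξ
    have hr : ‖euclFourier (Dmix n α u) ξ‖ ^ 2 =
        (‖euclFourier u ξ‖ ^ 2) ^ (1 - ∑ k, (α k : ℝ) / (l k : ℝ)) *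
        ∏ k, (‖euclFourier (pdIter n k (l k) u) ξ‖ ^ 2) ^ ((α k : ℝ) / (l k : ℝ)) := by
      simp only [norm_euclFourier_Dmix, norm_euclFourier_pdIter]
      have hk : ∀ k, (((2 * Real.pi * |ξ k|) ^ l k * ‖euclFourier u ξ‖) ^ 2) ^
          ((α k : ℝ) / (l k : ℝ)) = ((2 * Real.pi * |ξ k|) ^ α k) ^ 2 *
            (‖euclFourier u ξ‖ ^ 2) ^ ((α k : ℝ) / (l k : ℝ)) := by
        intro k
        have hlk : (l k : ℝ) ≠ 0 := by exact_mod_cast (hl k).ne'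
        rw [mul_pow, Real.mul_rpow (by positivity) (by positivity), ← pow_mul, mul_comm (l k),
          pow_mul, ← Real.rpow_natCast _ (l k), ← Real.rpow_mul (by positivity),
          mul_div_cancel₀ _ hlk, Real.rpow_natCast, pow_right_comm]
      rw [Finset.prod_congr rfl fun k _ => hk k, Finset.prod_mul_distrib,
        ← Real.rpow_sum_of_nonneg (by positivity) (fun k _ => hp k), mul_left_comm,
        ← Real.rpow_add_of_nonneg (by positivity) hq (Finset.sum_nonneg fun k _ => hp k),
        sub_add_cancel, Real.rpow_one, Finset.prod_pow, mul_pow]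
    have hof : ∀ v : H, ‖v‖ₑ ^ 2 = ENNReal.ofReal (‖v‖ ^ 2) := fun v => by
      rw [ENNReal.ofReal_pow (norm_nonneg _), ofReal_norm]
    simp only [hof]
    rw [hr, ENNReal.ofReal_mul (by positivity), ENNReal.ofReal_prod_of_nonneg
      (fun _ _ => by positivity), ENNReal.ofReal_rpow_of_nonneg (by positivity) hq]
    congr 1
    exact Finset.prod_congr rfl fun k _ =>
      (ENNReal.ofReal_rpow_of_nonneg (by positivity) (hp k)).symm
  have hpos : ∀ k, 0 ≤ L2N n (fun x => pdIter n k (l k) u x) ^ ((α k : ℝ) / (l k : ℝ)) :=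
    fun k => Real.rpow_nonneg (L2N_nonneg _) _
  rw [← ENNReal.ofReal_le_ofReal_iff (mul_nonneg (Real.rpow_nonneg (L2N_nonneg _) _)
    (Finset.prod_nonneg fun k _ => hpos k)), ENNReal.ofReal_mul
    (Real.rpow_nonneg (L2N_nonneg _) _), ENNReal.ofReal_prod_of_nonneg (fun k _ => hpos k),
    ← ENNReal.ofReal_rpow_of_nonneg (L2N_nonneg _) hq, Finset.prod_congr rfl fun k _ =>
      (ENNReal.ofReal_rpow_of_nonneg (L2N_nonneg _) (hp k)).symm]
  simp only [ofReal_L2N, hpt]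
  refine (ENNReal.rpow_le_rpow key (by norm_num)).trans_eq ?_
  rw [ENNReal.mul_rpow_of_nonneg _ _ (by norm_num), ← ENNReal.prod_rpow_of_nonneg (by norm_num)]
  simp only [← ENNReal.rpow_mul, mul_comm ((1 : ℝ) / 2)]

end Fourier

/-- Result 3.1 (multiplicative estimate (3.11)) in the Hilbert-space case with `p = q = 2`
and weight `γ ≡ 1`: `‖A^(1-ϰ-μ) D^α u‖_{L²} ≤ C_μ (‖A u‖_{L²} + ∑ k, ‖∂ₖ^{l k} u‖_{L²}
+ ‖u‖_{L²})^(1-μ) ‖u‖_{L²}^μ`. -/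
theorem multiplicative_embedding_estimate_hilbert {H : Type*} [NormedAddCommGroup H]
    [InnerProductSpace ℂ H] [CompleteSpace H] (A : H →L[ℂ] H) (hA : IsSelfAdjoint A)
    (c : ℝ) (hc : 0 < c) (hcoer : ∀ u : H, c * ‖u‖ ^ 2 ≤ (inner ℂ (A u) u : ℂ).re)
    (n : ℕ) (l : Fin n → ℕ) (hl : ∀ k, 0 < l k) (α : Fin n → ℕ)
    (hϰ : (∑ k, (α k : ℝ) / (l k : ℝ)) ≤ 1) (μ : ℝ) (hμ0 : 0 < μ)
    (hμ1 : μ ≤ 1 - ∑ k, (α k : ℝ) / (l k : ℝ)) :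
    ∃ C : ℝ, 0 < C ∧ ∀ u : SchwartzMap (Fin n → ℝ) H,
      L2N n (fun x => fracPow A (1 - (∑ k, (α k : ℝ) / (l k : ℝ)) - μ) (Dmix n α u x))
      ≤ C * (L2N n (fun x => A (u x)) + (∑ k, L2N n (fun x => pdIter n k (l k) u x)) +
              L2N n (fun x => u x)) ^ (1 - μ) *
          (L2N n (fun x => u x)) ^ μ := by
  set κ := ∑ k, (α k : ℝ) / (l k : ℝ) with hκ
  have hp : ∀ k, 0 ≤ (α k : ℝ) / (l k : ℝ) := fun k => by positivity
  have hκ0 : 0 ≤ κ := Finset.sum_nonneg fun k _ => hp k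
  refine ⟨‖fracPow A (1 - κ - μ)‖ + 1, by positivity, fun u => ?_⟩
  refine (L2N_clm_comp_le _ _).trans ?_
  have hGN := L2N_Dmix_le l hl α hϰ u
  rw [← hκ] at hGN
  have hA0 := L2N_nonneg (n := n) fun x => A (u x)
  have hN0 := L2N_nonneg (n := n) fun x => u x
  have hP0 := fun k => L2N_nonneg (n := n) fun x => pdIter n k (l k) u x
  set S := L2N n (fun x => A (u x)) + (∑ k, L2N n (fun x => pdIter n k (l k) u x)) +
    L2N n (fun x => u x) with hS
  have hsum0 := Finset.sum_nonneg fun k (_ : k ∈ Finset.univ) => hP0 k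
  have hNS : L2N n (fun x => u x) ≤ S := by linarith
  have hS0 : 0 ≤ S := hN0.trans hNS
  have hPS : ∀ k, L2N n (fun x => pdIter n k (l k) u x) ≤ S := fun k => by
    have := Finset.single_le_sum (fun k _ => hP0 k) (Finset.mem_univ k)
    linarith
  have hprod : ∏ k, L2N n (fun x => pdIter n k (l k) u x) ^ ((α k : ℝ) / (l k : ℝ)) ≤ S ^ κ := by
    rw [hκ, Real.rpow_sum_of_nonneg hS0 fun k _ => hp k]
    exact Finset.prod_le_prod (fun k _ => Real.rpow_nonneg (hP0 k) _)
      fun k _ => Real.rpow_le_rpow (hP0 k) (hPS k) (hp k)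
  have hmain : L2N n (fun x => Dmix n α u x) ≤ S ^ (1 - μ) * L2N n (fun x => u x) ^ μ := by
    calc _ ≤ L2N n (fun x => u x) ^ (1 - κ) * S ^ κ :=
          hGN.trans (mul_le_mul_of_nonneg_left hprod (Real.rpow_nonneg hN0 _))
      _ = L2N n (fun x => u x) ^ (1 - κ - μ) * S ^ κ * L2N n (fun x => u x) ^ μ := by
          rw [mul_right_comm, ← Real.rpow_add_of_nonneg hN0 (by linarith) hμ0.le, sub_add_cancel]
      _ ≤ S ^ (1 - κ - μ) * S ^ κ * L2N n (fun x => u x) ^ μ := by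
          have := Real.rpow_le_rpow hN0 hNS (by linarith : 0 ≤ 1 - κ - μ)
          gcongr
      _ = _ := by
          rw [← Real.rpow_add_of_nonneg hS0 (by linarith) hκ0]
          ring_nf
  rw [mul_assoc]
  have := norm_nonneg (fracPow A (1 - κ - μ))
  exact mul_le_mul (by linarith) hmain (L2N_nonneg _) (by linarith)
end
end
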